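/- arXiv:2107.01679 — 2 statements merged into one kernel-verified Lean document; each statement's English description precedes it below -/
import Mathlib

section
/- Let f : Y → X be a morphism of integral schemes where X is excellent and Y is normal, and suppose f maps the generic point of Y to a normal point of X. Then f factors uniquely through the normalization ν : X^ν → X, i.e., there exists a unique morphism f' : Y → X^ν with ν ∘ f' = f. -/
/-!
STATEMENT 2: Let `f : Y → X` be a morphism of integral schemes where `X` is excellent and
`Y` is normal, and suppose `f` maps the generic point of `Y` to a normal point of `X`.
Then `f` factors uniquely through the normalization `ν : Xᵛ → X`.

Normality and "being the normalization" are encoded as in the previous statements.  Of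
excellence we record the properties relevant here (all satisfied by excellent schemes):
local noetherianity, and openness of the normal locus of any integral closed subscheme
(by [EGA IV, 7.8.3] the normal locus of an excellent scheme is open, and closed subschemes
of excellent schemes are excellent).  A *normal point* of `X` is a point whose local ring
is an integrally closed domain.
-/

open AlgebraicGeometry CategoryTheory

universe u

/-- A scheme is normal if it is integral and all stalks are integrally closed domains. -/
def AlgebraicGeometry.Scheme.IsNormalScheme (X : Scheme.{u}) : Prop :=
  IsIntegral X ∧ ∀ x : X, IsIntegrallyClosed (X.presheaf.stalk x)

/-- `ν : Xᵛ ⟶ X` is the normalization of the integral scheme `X`. -/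
def AlgebraicGeometry.IsNormalizationMorphism {Xv X : Scheme.{u}} (ν : Xv ⟶ X) : Prop :=
  Xv.IsNormalScheme ∧ IsIntegralHom ν ∧ IsDominant ν ∧
    ∀ x : Xv, IsGenericPoint x Set.univ → IsIso (ν.stalkMap x)

/-- The consequences of excellence used here: `X` is locally noetherian and the normal
locus of every integral closed subscheme of `X` is open. -/
def AlgebraicGeometry.IsExcellentScheme (X : Scheme.{u}) : Prop :=
  IsLocallyNoetherian X ∧
    ∀ (Z : Scheme.{u}) (i : Z ⟶ X), IsClosedImmersion i → IsIntegral Z →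
      IsOpen {z : Z | IsIntegrallyClosed (Z.presheaf.stalk z)}


section helpers

open Limits

lemma aux_ring_lift {A C O K : Type*} [CommRing A] [CommRing C] [CommRing O] [IsDomain O]
    [IsIntegrallyClosed O] [Field K] [Algebra O K] [IsFractionRing O K]
    (α : A →+* C) (hα : α.IsIntegral) (β : A →+* O) (g : C →+* K)
    (h : g.comp α = (algebraMap O K).comp β) :
    ∃ t : C →+* O, (algebraMap O K).comp t = g ∧ t.comp α = β := by
  have hinj : Function.Injective (algebraMap O K) := IsFractionRing.injective O K
  have key : ∀ c, g c ∈ (algebraMap O K).range := by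
    intro c
    have h1 : ((algebraMap O K).comp β).IsIntegralElem (g c) := by
      rw [← h]
      obtain ⟨p, hp, hpc⟩ := hα c
      refine ⟨p, hp, ?_⟩
      rw [← Polynomial.hom_eval₂, hpc, map_zero]
    have h2 : IsIntegral O (g c) := by
      obtain ⟨p, hp, hpc⟩ := h1
      refine ⟨p.map β, hp.map _, ?_⟩
      rw [Polynomial.eval₂_map]
      exact hpc
    exact IsIntegrallyClosed.isIntegral_iff.mp h2
  let e : O ≃+* (algebraMap O K).range := RingEquiv.ofBijective (algebraMap O K).rangeRestrict
    ⟨fun a b hab => hinj congr(($hab).1), (algebraMap O K).rangeRestrict_surjective⟩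
  let t : C →+* O := e.symm.toRingHom.comp (g.codRestrict _ key)
  have ht : ∀ c, algebraMap O K (t c) = g c := by
    intro c
    have : e (t c) = g.codRestrict _ key c := e.apply_symm_apply _
    exact congr(($this).1)
  refine ⟨t, RingHom.ext ht, RingHom.ext fun a => hinj ?_⟩
  rw [RingHom.comp_apply, ht]
  exact RingHom.congr_fun h a

/-- sections of a normal scheme over a nonempty affine open are integrally closed -/
lemma aux_isIntegrallyClosed {Y : Scheme.{u}} [IsIntegral Y]
    (hY : ∀ x : Y, IsIntegrallyClosed (Y.presheaf.stalk x)) (U : Y.Opens) (hU : IsAffineOpen U)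
    [Nonempty U] : IsIntegrallyClosed Γ(Y, U) := by
  have hmem : ∀ P : PrimeSpectrum Γ(Y, U), hU.fromSpec P ∈ U := fun P => by
    rw [← SetLike.mem_coe, ← hU.range_fromSpec]; exact ⟨P, rfl⟩
  refine IsIntegrallyClosed.of_localization_maximal fun P _ hP => ?_
  let alg : Algebra Γ(Y, U) (Y.presheaf.stalk (hU.fromSpec ⟨P, hP.isPrime⟩)) :=
    TopCat.Presheaf.algebra_section_stalk Y.presheaf
      (⟨hU.fromSpec ⟨P, hP.isPrime⟩, hmem _⟩ : U)
  have loc : IsLocalization P.primeCompl (Y.presheaf.stalk (hU.fromSpec ⟨P, hP.isPrime⟩)) :=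
    hU.isLocalization_stalk' ⟨P, hP.isPrime⟩ (hmem _)
  have := hY (hU.fromSpec ⟨P, hP.isPrime⟩)
  exact IsIntegrallyClosed.of_equiv (IsLocalization.algEquiv P.primeCompl
    (Y.presheaf.stalk (hU.fromSpec ⟨P, hP.isPrime⟩)) (Localization.AtPrime P)).toRingEquiv

/-- key local lemma. -/
lemma aux_local {X Xv : Scheme.{u}} [IsIntegral X] [IsIntegral Xv] (ν : Xv ⟶ X)
    [IsIntegralHom ν] [IsDominant ν] [IsIso (ν.stalkMap (genericPoint Xv))]
    (x : X) (hx : IsIntegrallyClosed (X.presheaf.stalk x)) (U : X.Opens) (hU : IsAffineOpen U)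
    (hxU : x ∈ U) :
    ∃ t : Γ(Xv, ν ⁻¹ᵁ U) ⟶ X.presheaf.stalk x, Function.Injective t ∧
      ν.app U ≫ t = X.presheaf.germ U x hxU := by
  have hgen : closure {ν (genericPoint Xv)} = Set.univ := by
    have h1 := (genericPoint_spec Xv).image ν.continuous
    rw [isGenericPoint_def] at h1
    rw [h1, Set.image_univ]
    exact ν.denseRange.closure_range
  have hsp : ν (genericPoint Xv) ⤳ x := by
    rw [specializes_iff_mem_closure, hgen]; trivial
  have hηU : ν (genericPoint Xv) ∈ U := hsp.mem_open U.2 hxU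
  let s := (genericPoint_spec X).specializes (Set.mem_univ (ν (genericPoint Xv)))
  let g : Γ(Xv, ν ⁻¹ᵁ U) ⟶ X.functionField :=
    Xv.presheaf.germ (ν ⁻¹ᵁ U) (genericPoint Xv) hηU ≫ inv (ν.stalkMap (genericPoint Xv)) ≫
      X.presheaf.stalkSpecializes s
  have hg : Function.Injective g := by
    have h1 : Function.Injective (X.presheaf.stalkSpecializes s) :=
      IsFractionRing.injective (X.presheaf.stalk (ν (genericPoint Xv))) X.functionField
    have h2 : Function.Injective (inv (ν.stalkMap (genericPoint Xv))) :=
      (ConcreteCategory.bijective_of_isIso (inv (ν.stalkMap (genericPoint Xv)))).1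
    have h3 := germ_injective_of_isIntegral Xv (genericPoint Xv) (U := ν ⁻¹ᵁ U) hηU
    intro a b hab
    simp only [g, CommRingCat.comp_apply] at hab
    exact h3 (h2 (h1 hab))
  have hcomp : ν.app U ≫ g = X.presheaf.germ U x hxU ≫ X.presheaf.stalkSpecializes
      ((genericPoint_spec X).specializes (Set.mem_univ x)) := by
    simp only [g]
    rw [← Scheme.Hom.germ_stalkMap_assoc ν U (genericPoint Xv) hηU, IsIso.hom_inv_id_assoc,
      TopCat.Presheaf.germ_stalkSpecializes, TopCat.Presheaf.germ_stalkSpecializes]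
  obtain ⟨t, ht1, ht2⟩ := aux_ring_lift (O := X.presheaf.stalk x) (K := X.functionField)
    (ν.app U).hom (ν.isIntegral_app U hU)
    (X.presheaf.germ U x hxU).hom g.hom congr(($hcomp).hom)
  refine ⟨CommRingCat.ofHom t, ?_, by ext1; exact ht2⟩
  intro a b hab
  apply hg
  have := RingHom.congr_fun ht1 a
  have h' := RingHom.congr_fun ht1 b
  change g.hom a = g.hom b
  rw [← this, ← h']
  exact congrArg (algebraMap (X.presheaf.stalk x) X.functionField) hab

/-- Existence of a lift of the local scheme. -/
lemma aux_exists {X Xv : Scheme.{u}} [IsIntegral X] [IsIntegral Xv] (ν : Xv ⟶ X)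
    [IsIntegralHom ν] [IsDominant ν] [IsIso (ν.stalkMap (genericPoint Xv))]
    (x : X) (hx : IsIntegrallyClosed (X.presheaf.stalk x)) :
    ∃ g : Spec (X.presheaf.stalk x) ⟶ Xv, g ≫ ν = X.fromSpecStalk x := by
  obtain ⟨_, ⟨U, hU, rfl⟩, hxU, -⟩ := X.isBasis_affineOpens.exists_subset_of_mem_open
    (Set.mem_univ x) isOpen_univ
  replace hU : IsAffineOpen U := hU
  replace hxU : x ∈ U := hxU
  obtain ⟨t, -, ht⟩ := aux_local ν x hx U hU hxU
  refine ⟨Spec.map t ≫ (hU.preimage ν).fromSpec, ?_⟩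
  rw [Category.assoc, ← IsAffineOpen.SpecMap_appLE_fromSpec ν hU _ le_rfl, ← Spec.map_comp_assoc,
    ← Scheme.Hom.app_eq_appLE, ht, ← hU.fromSpecStalk_eq_fromSpecStalk hxU]
  rfl

lemma aux_unique {X Xv : Scheme.{u}} [IsIntegral X] [IsIntegral Xv] (ν : Xv ⟶ X)
    [IsIntegralHom ν] [IsDominant ν] [IsIso (ν.stalkMap (genericPoint Xv))]
    (x : X) (hx : IsIntegrallyClosed (X.presheaf.stalk x)) (K : CommRingCat.{u})
    (χ : X.presheaf.stalk x ⟶ K) (g₁ g₂ : Spec K ⟶ Xv)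
    (h₁ : g₁ ≫ ν = Spec.map χ ≫ X.fromSpecStalk x)
    (h₂ : g₂ ≫ ν = Spec.map χ ≫ X.fromSpecStalk x) : g₁ = g₂ := by
  obtain ⟨_, ⟨U, hU, rfl⟩, hxU, -⟩ := X.isBasis_affineOpens.exists_subset_of_mem_open
    (Set.mem_univ x) isOpen_univ
  replace hU : IsAffineOpen U := hU
  replace hxU : x ∈ U := hxU
  obtain ⟨t, ht, htg⟩ := aux_local ν x hx U hU hxU
  have key : ∀ g : Spec K ⟶ Xv, g ≫ ν = Spec.map χ ≫ X.fromSpecStalk x →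
      ∃ φ : Γ(Xv, ν ⁻¹ᵁ U) ⟶ K, g = Spec.map φ ≫ (hU.preimage ν).fromSpec ∧
        ν.app U ≫ φ = X.presheaf.germ U x hxU ≫ χ := by
    intro g hg
    have hfs : X.fromSpecStalk x = Spec.map (X.presheaf.germ U x hxU) ≫ hU.fromSpec :=
      (hU.fromSpecStalk_eq_fromSpecStalk hxU).symm
    rw [hfs, ← Spec.map_comp_assoc] at hg
    have hr : Set.range g ⊆ Set.range (hU.preimage ν).fromSpec := by
      rw [IsAffineOpen.range_fromSpec]
      rintro _ ⟨z, rfl⟩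
      change ν (g z) ∈ U
      rw [← Scheme.Hom.comp_apply, hg, Scheme.Hom.comp_apply, ← SetLike.mem_coe,
        ← hU.range_fromSpec]
      exact ⟨_, rfl⟩
    obtain ⟨φ, hφ⟩ := Spec.map_surjective (IsOpenImmersion.lift (hU.preimage ν).fromSpec g hr)
    have hg' : g = Spec.map φ ≫ (hU.preimage ν).fromSpec := by
      rw [hφ, IsOpenImmersion.lift_fac]
    refine ⟨φ, hg', ?_⟩
    rw [hg', Category.assoc, ← IsAffineOpen.SpecMap_appLE_fromSpec ν hU _ le_rfl,
      ← Spec.map_comp_assoc, cancel_mono, ← Scheme.Hom.app_eq_appLE] at hg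
    exact Spec.map_injective hg
  obtain ⟨φ₁, e₁, f₁⟩ := key g₁ h₁
  obtain ⟨φ₂, e₂, f₂⟩ := key g₂ h₂
  suffices φ₁ = φ₂ by rw [e₁, e₂, this]
  ext c
  let alg : Algebra Γ(X, U) (X.presheaf.stalk (⟨x, hxU⟩ : U).1) :=
    TopCat.Presheaf.algebra_section_stalk X.presheaf (⟨x, hxU⟩ : U)
  have hloc : IsLocalization (hU.primeIdealOf ⟨x, hxU⟩).asIdeal.primeCompl
    (X.presheaf.stalk (⟨x, hxU⟩ : U).1) := hU.isLocalization_stalk ⟨x, hxU⟩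
  obtain ⟨⟨a, s⟩, has⟩ := IsLocalization.surj (S := X.presheaf.stalk (⟨x, hxU⟩ : U).1)
    (hU.primeIdealOf ⟨x, hxU⟩).asIdeal.primeCompl (t c)
  have has' : t c * X.presheaf.germ U x hxU s = X.presheaf.germ U x hxU a := has
  have hu : IsUnit (X.presheaf.germ U x hxU s) := 
    IsLocalization.map_units (X.presheaf.stalk (⟨x, hxU⟩ : U).1) s
  have hc : c * ν.app U s = ν.app U a := by
    apply ht
    rw [map_mul, ← CommRingCat.comp_apply, ← CommRingCat.comp_apply, htg, has']
  have hs : ∀ b, φ₁ (ν.app U b) = φ₂ (ν.app U b) := fun b => by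
    rw [← CommRingCat.comp_apply, ← CommRingCat.comp_apply, f₁, f₂]
  have hu' : IsUnit (φ₂ (ν.app U s)) := by
    rw [← CommRingCat.comp_apply, f₂, CommRingCat.comp_apply]
    exact hu.map χ.hom
  have e1 := congrArg φ₁ hc
  have e2 := congrArg φ₂ hc
  rw [map_mul, hs, hs] at e1
  rw [map_mul] at e2
  exact hu'.mul_right_cancel (e1.trans e2.symm)

lemma aux_dominant (Y : Scheme.{u}) [IsIntegral Y] :
    IsDominant (Y.fromSpecStalk (genericPoint Y)) := by
  refine ⟨?_⟩
  rw [denseRange_iff_closure_range]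
  refine Set.eq_univ_of_univ_subset ?_
  rw [← (genericPoint_spec Y).def]
  apply closure_mono
  rintro _ rfl
  exact ⟨_, Scheme.fromSpecStalk_closedPoint⟩

lemma aux_normalization {Y : Scheme.{u}} [IsIntegral Y]
    (hY : ∀ x : Y, IsIntegrallyClosed (Y.presheaf.stalk x))
    [QuasiCompact (Y.fromSpecStalk (genericPoint Y))]
    [QuasiSeparated (Y.fromSpecStalk (genericPoint Y))] :
    IsIso (Y.fromSpecStalk (genericPoint Y)).fromNormalization := by
  set j := Y.fromSpecStalk (genericPoint Y) with hj
  have : MorphismProperty.isomorphisms Scheme j.fromNormalization := by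
    rw [IsZariskiLocalAtTarget.iff_of_iSup_eq_top (P := MorphismProperty.isomorphisms Scheme) _
      (iSup_affineOpens_eq_top Y)]
    rintro ⟨U, hU⟩
    change IsIso (j.fromNormalization ∣_ U)
    rw [isIso_morphismRestrict_iff_isIso_app _ hU, j.fromNormalization_app hU]
    let := (j.app U).hom.toAlgebra
    suffices hb : Function.Bijective (algebraMap Γ(Y, U)
        (integralClosure Γ(Y, U) Γ(Spec (Y.presheaf.stalk (genericPoint Y)), j ⁻¹ᵁ U))) by
      have : IsIso (CommRingCat.ofHom (algebraMap Γ(Y, U)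
        (integralClosure Γ(Y, U) Γ(Spec (Y.presheaf.stalk (genericPoint Y)), j ⁻¹ᵁ U)))) :=
        (ConcreteCategory.isIso_iff_bijective _).mpr hb
      exact IsIso.comp_isIso' this inferInstance
    by_cases hne : Nonempty U
    · have hη : genericPoint Y ∈ U :=
        ((genericPoint_spec Y).mem_open_set_iff U.isOpen).mpr (by simpa using hne)
      have htop : j ⁻¹ᵁ U = ⊤ := by
        apply Scheme.preimage_eq_top_of_closedPoint_mem
        rw [hj, Scheme.fromSpecStalk_closedPoint]
        exact hη
      have happ := Y.fromSpecStalk_app (x := genericPoint Y) hη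
      rw [← hj] at happ
      let θ : Y.functionField ⟶ Γ(Spec (Y.presheaf.stalk (genericPoint Y)), j ⁻¹ᵁ U) :=
        (Scheme.ΓSpecIso (Y.presheaf.stalk (genericPoint Y))).inv ≫
          (Spec (Y.presheaf.stalk (genericPoint Y))).presheaf.map (homOfLE le_top).op
      have hθ : IsIso θ := by
        have : (homOfLE le_top : j ⁻¹ᵁ U ⟶ ⊤) = eqToHom htop := Subsingleton.elim _ _
        simp only [θ]
        rw [this]
        infer_instance
      have happ' : j.app U = Y.germToFunctionField U ≫ θ := happ
      have hic := aux_isIntegrallyClosed hY U hU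
      have hfr := functionField_isFractionRing_of_isAffineOpen Y U hU
      have hθb := ConcreteCategory.bijective_of_isIso θ
      have halg : ∀ a, algebraMap Γ(Y, U)
          Γ(Spec (Y.presheaf.stalk (genericPoint Y)), j ⁻¹ᵁ U) a
          = θ (algebraMap Γ(Y,U) Y.functionField a) := fun a => by
        change j.app U a = _
        rw [happ']; rfl
      constructor
      · intro a b hab
        have h1 := congrArg Subtype.val hab
        change algebraMap Γ(Y, U) Γ(Spec (Y.presheaf.stalk (genericPoint Y)), j ⁻¹ᵁ U) a =
          algebraMap Γ(Y, U) Γ(Spec (Y.presheaf.stalk (genericPoint Y)), j ⁻¹ᵁ U) b at h1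
        rw [halg, halg] at h1
        exact IsFractionRing.injective Γ(Y, U) Y.functionField (hθb.1 h1)
      · rintro ⟨z, hz⟩
        obtain ⟨k, rfl⟩ := hθb.2 z
        have hk : IsIntegral Γ(Y, U) k := by
          obtain ⟨p, hp, hpz⟩ := hz
          refine ⟨p, hp, hθb.1 ?_⟩
          change θ.hom _ = θ.hom _
          rw [map_zero, Polynomial.hom_eval₂, ← hpz]
          congr 1
          ext a
          exact (halg a).symm
        obtain ⟨a, ha⟩ := IsIntegrallyClosed.isIntegral_iff.mp hk
        refine ⟨a, Subtype.ext ?_⟩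
        exact (halg a).trans (by rw [ha])
    · have hU0 : U = ⊥ := by
        ext z
        simpa using fun hz => hne ⟨⟨z, hz⟩⟩
      subst hU0
      have : Subsingleton Γ(Y, (⊥ : Y.Opens)) := inferInstance
      have hs2 : Subsingleton (integralClosure Γ(Y, (⊥ : Y.Opens))
          Γ(Spec (Y.presheaf.stalk (genericPoint Y)), j ⁻¹ᵁ ⊥)) :=
        (algebraMap Γ(Y, (⊥ : Y.Opens)) (integralClosure Γ(Y, (⊥ : Y.Opens))
          Γ(Spec (Y.presheaf.stalk (genericPoint Y)), j ⁻¹ᵁ ⊥))).codomain_trivial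
      exact ⟨fun a b _ => Subsingleton.elim _ _, fun z => ⟨0, Subsingleton.elim _ _⟩⟩
  exact this

lemma aux_extend {X Xv Y : Scheme.{u}} [IsIntegral Y]
    (hY : ∀ x : Y, IsIntegrallyClosed (Y.presheaf.stalk x)) (ν : Xv ⟶ X) [IsIntegralHom ν]
    (f : Y ⟶ X) (g : Spec (Y.presheaf.stalk (genericPoint Y)) ⟶ Xv)
    (hg : g ≫ ν = Y.fromSpecStalk (genericPoint Y) ≫ f) :
    ∃ f' : Y ⟶ Xv, f' ≫ ν = f := by
  set j := Y.fromSpecStalk (genericPoint Y) with hj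
  have : QuasiCompact j := by
    refine ⟨fun V hV _ => ?_⟩
    have hfin : Finite (Spec (Y.presheaf.stalk (genericPoint Y))) := 
      inferInstanceAs (Finite (PrimeSpectrum Y.functionField))
    exact (Set.toFinite _).isCompact
  have : QuasiSeparated j := by
    infer_instance
  have := aux_normalization hY
  let d := j.normalizationDesc (pullback.lift j g hg.symm) (pullback.fst f ν)
    (pullback.lift_fst _ _ _).symm
  refine ⟨inv j.fromNormalization ≫ d ≫ pullback.snd f ν, ?_⟩
  rw [Category.assoc, Category.assoc, ← pullback.condition, IsIso.inv_comp_eq]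
  simp [d]

end helpers

theorem factors_through_normalization_of_genericPoint_normal
    {X Xv Y : Scheme.{u}} [IsIntegral X] [IsIntegral Y]
    (hexc : IsExcellentScheme X)
    (ν : Xv ⟶ X) (hν : IsNormalizationMorphism ν)
    (hY : Y.IsNormalScheme)
    (f : Y ⟶ X)
    (hnormal : IsIntegrallyClosed (X.presheaf.stalk (f.base (genericPoint Y)))) :
    ∃! f' : Y ⟶ Xv, f' ≫ ν = f := by
  obtain ⟨⟨hXv, -⟩, hint, hdom, hiso⟩ := hν
  have := hiso (genericPoint Xv) (genericPoint_spec Xv)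
  have hn : IsIntegrallyClosed (X.presheaf.stalk (f (genericPoint Y))) := hnormal
  obtain ⟨g, hg⟩ := aux_exists ν (f (genericPoint Y)) hn
  obtain ⟨f', hf'⟩ := aux_extend hY.2 ν f (Spec.map (f.stalkMap (genericPoint Y)) ≫ g) (by
    rw [Category.assoc, hg, Scheme.SpecMap_stalkMap_fromSpecStalk])
  refine ⟨f', hf', fun f'' hf'' => ?_⟩
  have := aux_dominant Y
  refine ext_of_isDominant_of_isSeparated ν (hf''.trans hf'.symm)
    (Y.fromSpecStalk (genericPoint Y)) ?_
  refine aux_unique ν (f (genericPoint Y)) hn _ (f.stalkMap (genericPoint Y)) _ _ ?_ ?_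
  · rw [Category.assoc, hf'', Scheme.SpecMap_stalkMap_fromSpecStalk]
  · rw [Category.assoc, hf', Scheme.SpecMap_stalkMap_fromSpecStalk]
end

section
/- Let X be a smooth projective surface, T*_X its cotangent bundle, and μ = (1^{α₁}, …, s^{α_s}) a partition of n. Then the relative addition morphism τ_μ : Chow^{α₁}(T*_X/X) ×_X ⋯ ×_X Chow^{α_s}(T*_X/X) → Chowⁿ(T*_X/X), (z₁,…,z_s) ↦ Σᵢ i·zᵢ, is the normalization of the closure of the stratum Chowⁿ_μ(T*_X/X). -/
/-!
STATEMENT 10: Let `X` be a smooth projective surface, `T*_X` its cotangent bundle, and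
`μ = (1^{α₁},…,s^{α_s})` a partition of `n`.  The relative addition morphism
`τ_μ : Chow^{α₁}(T*_X/X) ×_X ⋯ ×_X Chow^{α_s}(T*_X/X) → Chowⁿ(T*_X/X)` is the
normalization of the closure of the stratum `Chowⁿ_μ(T*_X/X)`.

As in the paper (Proposition 3.3), normalization is checked over an open cover of `X`
trivializing `T*_X`; we formalize the statement over such a chart `Spec R`, `R` a smooth
`k`-algebra domain of dimension `2`.  With coefficients in `R`:
`Aₙ = R[x_{j,l}]^{𝔖ₙ}` is the coordinate ring of `Chowⁿ(T*_X/X)` over the chart,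
`A_α = R[x_{(i,j),l}]^{𝔖_{α₁}×⋯×𝔖_{α_s}}` that of the fibre product of the
`Chow^{αᵢ}(T*_X/X)`, and `τ_μ*` is induced by duplicating points along
`e : Fin n → ι = Σᵢ Fin αᵢ` with fibres of cardinality `i+1`.  "`τ_μ` is the normalization
of the closure of the stratum" is then expressed by (1)–(5) below, as in STATEMENT 9, with
the stratum points now taken in arbitrary field extensions `L` of `R` (the stratum is
fibred over `X`).
-/

open MvPolynomial

/-- `𝔖ₙ`-invariants of `R[x_{j,l}]`: coordinate ring of `Chowⁿ` of the trivialized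
cotangent bundle. -/
noncomputable def chowInvariants (R : Type*) [CommRing R] (n d : ℕ) :
    Subalgebra R (MvPolynomial (Fin n × Fin d) R) where
  carrier := {p | ∀ σ : Equiv.Perm (Fin n), rename (fun q => (σ q.1, q.2)) p = p}
  mul_mem' {a b} ha hb := fun σ => by rw [map_mul, ha σ, hb σ]
  add_mem' {a b} ha hb := fun σ => by rw [map_add, ha σ, hb σ]
  one_mem' := fun σ => by rw [map_one]
  zero_mem' := fun σ => by rw [map_zero]
  algebraMap_mem' r := fun σ => by simp [MvPolynomial.algebraMap_eq, rename_C]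

/-- Block invariants: coordinate ring of the fibre product of the `Chow^{αᵢ}`. -/
noncomputable def blockChowInvariants (R : Type*) [CommRing R] (s : ℕ) (α : Fin s → ℕ)
    (d : ℕ) : Subalgebra R (MvPolynomial ((Σ i : Fin s, Fin (α i)) × Fin d) R) where
  carrier := {p | ∀ σ : Equiv.Perm (Σ i : Fin s, Fin (α i)),
    (∀ j, (σ j).1 = j.1) → rename (fun q => (σ q.1, q.2)) p = p}
  mul_mem' {a b} ha hb := fun σ hσ => by rw [map_mul, ha σ hσ, hb σ hσ]
  add_mem' {a b} ha hb := fun σ hσ => by rw [map_add, ha σ hσ, hb σ hσ]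
  one_mem' := fun σ _ => by rw [map_one]
  zero_mem' := fun σ _ => by rw [map_zero]
  algebraMap_mem' r := fun σ _ => by simp [MvPolynomial.algebraMap_eq, rename_C]

section
open TensorProduct

theorem etale_normal (A S : Type*) [CommRing A] [CommRing S] [Algebra A S] [IsDomain A] [IsDomain S]
    [IsIntegrallyClosed A] [Algebra.Etale A S] : IsIntegrallyClosed S := by
  let K := FractionRing A
  let T := S ⊗[A] K
  have hinj : Function.Injective (algebraMap A S) := FaithfulSMul.algebraMap_injective A S
  have hle : Algebra.algebraMapSubmonoid S (nonZeroDivisors A) ≤ nonZeroDivisors S := by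
    rintro _ ⟨a, ha, rfl⟩
    rw [mem_nonZeroDivisors_iff_ne_zero] at *
    exact fun h => (nonZeroDivisors.ne_zero ha) (hinj (by simpa using h))
  have hloc : IsLocalization (Algebra.algebraMapSubmonoid S (nonZeroDivisors A)) T := inferInstance
  have hdom : IsDomain T := IsLocalization.isDomain_of_le_nonZeroDivisors T hle
  let eqv : K ⊗[A] S ≃+* T := (Algebra.TensorProduct.comm A K S).toRingEquiv
  have hdom' : IsDomain (K ⊗[A] S) := eqv.toMulEquiv.isDomain _
  have : Module.Finite K (K ⊗[A] S) := Algebra.FormallyUnramified.finite_of_free K _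
  have hf' : IsField (K ⊗[A] S) :=
    isField_of_isIntegral_of_isField' (R := K) (Field.toIsField K)
  have hf : IsField T := eqv.symm.toMulEquiv.isField hf'
  let _ := hf.toField
  have hi : Function.Injective (algebraMap S T) := IsLocalization.injective T hle
  have : FaithfulSMul S T := (faithfulSMul_iff_algebraMap_injective S T).2 hi
  have hfr : IsFractionRing S T := by
    apply IsFractionRing.of_field
    intro z
    obtain ⟨x, y, rfl⟩ := IsLocalization.exists_mk'_eq (Algebra.algebraMapSubmonoid S (nonZeroDivisors A)) z
    refine ⟨x, y, ?_⟩
    rw [eq_div_iff, IsLocalization.mk'_spec]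
    exact fun h => nonZeroDivisors.ne_zero (hle y.2) (hi (by simpa using h))
  rw [isIntegrallyClosed_iff T]
  intro x hx
  obtain ⟨y, hy⟩ := (TensorProduct.toIntegralClosure_bijective_of_smooth (R := A) (S := S) (B := K)).2 ⟨x, hx⟩
  have hy' : (TensorProduct.toIntegralClosure A S K y : T) = x := congrArg Subtype.val hy
  rw [← hy']
  clear hy hy'
  induction y with
  | zero => exact ⟨0, by simp⟩
  | add a b ha hb =>
    obtain ⟨a', ha⟩ := ha
    obtain ⟨b', hb⟩ := hb
    exact ⟨a' + b', by rw [map_add, ha, hb]; simp⟩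
  | tmul s b =>
    obtain ⟨a, ha⟩ := (isIntegrallyClosed_iff K).1 ‹IsIntegrallyClosed A› b.2
    refine ⟨a • s, ?_⟩
    change (a • s) ⊗ₜ[A] (1 : K) = s ⊗ₜ[A] (b : K)
    rw [← ha, TensorProduct.smul_tmul, Algebra.algebraMap_eq_smul_one]

theorem smooth_normal (k S : Type*) [Field k] [CommRing S] [Algebra k S] [IsDomain S]
    [Algebra.Smooth k S] : IsIntegrallyClosed S := by
  let F := FractionRing S
  rw [isIntegrallyClosed_iff F]
  intro x hx
  let I : Ideal S := 
    { carrier := {s | ∃ t, algebraMap S F t = algebraMap S F s * x}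
      zero_mem' := ⟨0, by simp⟩
      add_mem' := by
        rintro a b ⟨a', ha⟩ ⟨b', hb⟩
        exact ⟨a' + b', by rw [map_add, ha, hb, map_add, add_mul]⟩
      smul_mem' := by
        rintro c a ⟨a', ha⟩
        exact ⟨c * a', by rw [map_mul, ha, smul_eq_mul, map_mul, mul_assoc]⟩ }
  suffices hI : I = ⊤ by
    obtain ⟨t, ht⟩ : (1 : S) ∈ I := hI ▸ Submodule.mem_top
    exact ⟨t, by simpa using ht⟩
  by_contra hI
  obtain ⟨m, hm, hle⟩ := Ideal.exists_le_maximal I hI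
  have := hm.isPrime
  obtain ⟨f, hfm, n, _, _, _⟩ :=
      Algebra.IsSmoothAt.exists_isStandardEtale_mvPolynomial (R := k) (p := m)
  have hf0 : f ≠ 0 := fun h => hfm (h ▸ m.zero_mem)
  have hpow : Submonoid.powers f ≤ nonZeroDivisors S := powers_le_nonZeroDivisors_of_noZeroDivisors hf0
  have : IsDomain (Localization.Away f) := IsLocalization.isDomain_of_le_nonZeroDivisors _ hpow
  have hic : IsIntegrallyClosed (Localization.Away f) := etale_normal (MvPolynomial (Fin n) k) _
  let _ : Algebra (Localization.Away f) F := 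
    (IsLocalization.lift (M := Submonoid.powers f) (g := algebraMap S F) (fun y => 
      IsLocalization.map_units F (⟨y, hpow y.2⟩ : nonZeroDivisors S))).toAlgebra
  have : IsScalarTower S (Localization.Away f) F := .of_algebraMap_eq (fun s => by
    rw [RingHom.algebraMap_toAlgebra, IsLocalization.lift_eq])
  have : IsFractionRing (Localization.Away f) F := 
    IsFractionRing.isFractionRing_of_isDomain_of_isLocalization (Submonoid.powers f) _ _
  obtain ⟨y, hy⟩ := (isIntegrallyClosed_iff F).1 hic (hx.tower_top (A := Localization.Away f))
  obtain ⟨a, b, rfl⟩ := IsLocalization.exists_mk'_eq (Submonoid.powers f) y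
  have hb : (b : S) ∈ I := by
    refine ⟨a, ?_⟩
    rw [← hy, IsScalarTower.algebraMap_apply S (Localization.Away f) F, 
      IsScalarTower.algebraMap_apply S (Localization.Away f) F, ← map_mul, IsLocalization.mk'_spec']
  obtain ⟨j, hj⟩ := b.2
  exact hfm (hm.isPrime.mem_of_pow_mem j (by have := hle hb; rwa [← hj] at this))

theorem mv_normal (k S ι : Type*) [Field k] [CommRing S] [Algebra k S] [IsDomain S]
    [Algebra.Smooth k S] [Finite ι] : IsIntegrallyClosed (MvPolynomial ι S) := by
  have : Algebra.Smooth S (MvPolynomial ι S) := { }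
  have := Algebra.Smooth.comp k S (MvPolynomial ι S)
  exact smooth_normal k _

end

theorem tau_lift {n s : ℕ} {α : Fin s → ℕ} (e : Fin n → Σ i : Fin s, Fin (α i))
    (he : ∀ p : Σ i : Fin s, Fin (α i),
      (Finset.univ.filter fun j : Fin n => e j = p).card = p.1.1 + 1)
    (σ : Equiv.Perm (Σ i : Fin s, Fin (α i))) (hσ : ∀ j, (σ j).1 = j.1) :
    ∃ ρ : Equiv.Perm (Fin n), ∀ j, e (ρ j) = σ (e j) := by
  have hc : ∀ p, Nonempty ({j // e j = p} ≃ {j // e j = σ p}) := fun p => by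
    rw [← Fintype.card_eq, Fintype.card_subtype, Fintype.card_subtype, he, he, hσ]
  let F := fun p => (hc p).some
  refine ⟨((Equiv.sigmaFiberEquiv e).symm.trans (Equiv.sigmaCongr σ F)).trans
    (Equiv.sigmaFiberEquiv e), fun j => ?_⟩
  exact (F (e j) ⟨j, rfl⟩).2

theorem tau_image_le {R : Type*} [CommRing R] {n s : ℕ} {α : Fin s → ℕ}
    (e : Fin n → Σ i : Fin s, Fin (α i))
    (he : ∀ p : Σ i : Fin s, Fin (α i),
      (Finset.univ.filter fun j : Fin n => e j = p).card = p.1.1 + 1) :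
    Subalgebra.map (rename (fun q : Fin n × Fin 2 => (e q.1, q.2))) (chowInvariants R n 2)
      ≤ blockChowInvariants R s α 2 := by
  rintro _ ⟨f, hf, rfl⟩ σ hσ
  obtain ⟨ρ, hρ⟩ := tau_lift e he σ hσ
  have hf' : rename (fun q : Fin n × Fin 2 => (ρ q.1, q.2)) f = f := hf ρ
  change rename _ (rename _ f) = rename _ f
  conv_rhs => rw [← hf']
  rw [rename_rename, rename_rename]
  congr 2
  funext q
  simp [hρ]

theorem tau_integral {R : Type*} [CommRing R] {n s : ℕ} {α : Fin s → ℕ}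
    (e : Fin n → Σ i : Fin s, Fin (α i)) (hs : Function.Surjective e)
    (x : MvPolynomial ((Σ i : Fin s, Fin (α i)) × Fin 2) R) :
    IsIntegral ↥(Subalgebra.map (rename (fun q : Fin n × Fin 2 => (e q.1, q.2)))
      (chowInvariants R n 2)) x := by
  set R₀ := Subalgebra.map (rename (fun q : Fin n × Fin 2 => (e q.1, q.2)))
      (chowInvariants R n 2)
  induction x using MvPolynomial.induction_on with
  | C r => exact isIntegral_algebraMap (R := R₀) (x := algebraMap R R₀ r)
  | add p q hp hq => exact hp.add hq
  | mul_X p q hp =>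
    refine hp.mul ?_
    obtain ⟨p, l⟩ := q
    obtain ⟨j₀, rfl⟩ := hs p
    let Q : Polynomial (MvPolynomial (Fin n × Fin 2) R) :=
      ∏ j : Fin n, (Polynomial.X - Polynomial.C (X (j, l)))
    have hQ : ∀ i, Q.coeff i ∈ chowInvariants R n 2 := by
      intro i σ
      have : Q.map (rename (R := R) (fun q : Fin n × Fin 2 => (σ q.1, q.2))).toRingHom = Q := by
        simp only [Q, Polynomial.map_prod, Polynomial.map_sub, Polynomial.map_X, Polynomial.map_C]
        refine Fintype.prod_equiv σ _ _ fun j => ?_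
        simp
      conv_rhs => rw [← this]
      rw [Polynomial.coeff_map]
      rfl
    have hm : Q.Monic := Polynomial.monic_prod_of_monic _ _ fun j _ => Polynomial.monic_X_sub_C _
    let Q' := Q.map (rename (R := R) (fun q : Fin n × Fin 2 => (e q.1, q.2))).toRingHom
    have hQ' : Q' ∈ Polynomial.lifts (algebraMap R₀ (MvPolynomial ((Σ i : Fin s, Fin (α i)) × Fin 2) R)) := by
      rw [Polynomial.lifts_iff_coeff_lifts]
      intro i
      rw [Polynomial.coeff_map]
      exact ⟨⟨_, Q.coeff i, hQ i, rfl⟩, rfl⟩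
    obtain ⟨P, hP, -, hPm⟩ := Polynomial.lifts_and_natDegree_eq_and_monic hQ' (hm.map _)
    refine ⟨P, hPm, ?_⟩
    rw [← Polynomial.eval_map, hP]
    simp only [Q', Q, Polynomial.map_prod, Polynomial.map_sub, Polynomial.map_X, Polynomial.map_C,
      Polynomial.eval_prod]
    apply Finset.prod_eq_zero (Finset.mem_univ j₀)
    simp

theorem sym_mem {R : Type*} [CommRing R] {n : ℕ} (g : MvPolynomial (Fin n × Fin 2) R) :
    (∑ σ : Equiv.Perm (Fin n), rename (fun q : Fin n × Fin 2 => (σ q.1, q.2)) g)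
      ∈ chowInvariants R n 2 := by
  intro ρ
  rw [map_sum]
  refine Fintype.sum_equiv (Equiv.mulLeft ρ) _ _ fun σ => ?_
  rw [rename_rename]
  rfl

theorem good_perm {n s : ℕ} {α : Fin s → ℕ} (e : Fin n → Σ i : Fin s, Fin (α i))
    (he : ∀ p : Σ i : Fin s, Fin (α i),
      (Finset.univ.filter fun j : Fin n => e j = p).card = p.1.1 + 1)
    (t : (Σ i : Fin s, Fin (α i)) → Fin n) (ht : ∀ p, e (t p) = p)
    (σ : Equiv.Perm (Fin n)) (hσ : ∀ i j, e i ≠ e j → e (σ i) ≠ e (σ j)) :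
    (∀ i j, e (σ i) = e (σ j) ↔ e i = e j) ∧
    ∃ π : Equiv.Perm (Σ i : Fin s, Fin (α i)), (∀ p, π p = e (σ (t p))) ∧ ∀ p, (π p).1 = p.1 := by
  have hinj : Function.Injective (fun p => e (σ (t p))) := by
    intro p q h
    by_contra hne
    exact hσ (t p) (t q) (by rwa [ht, ht]) h
  let π : Equiv.Perm (Σ i : Fin s, Fin (α i)) :=
    Equiv.ofBijective _ (Finite.injective_iff_bijective.1 hinj)
  have hπ : ∀ p, π p = e (σ (t p)) := fun p => rfl
  have hc : ∀ j, e (σ j) = π (e j) := by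
    intro j
    obtain ⟨q, hq⟩ := π.surjective (e (σ j))
    have : e (t q) = e j := by
      by_contra hne
      exact hσ _ _ hne hq
    rw [ht] at this
    rw [← hq, this]
  refine ⟨fun i j => by rw [hc, hc, π.injective.eq_iff], π, hπ, fun p => ?_⟩
  have h1 : (Finset.univ.filter fun j : Fin n => e j = p).card =
      (Finset.univ.filter fun j : Fin n => e j = π p).card := by
    refine Finset.card_equiv σ fun j => ?_
    simp [hc]
  rw [he, he] at h1
  exact Fin.ext (by omega)

theorem tau_birational {R : Type*} [CommRing R] [IsDomain R] [CharZero R]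
    {n s : ℕ} {α : Fin s → ℕ}
    (e : Fin n → Σ i : Fin s, Fin (α i))
    (he : ∀ p : Σ i : Fin s, Fin (α i),
      (Finset.univ.filter fun j : Fin n => e j = p).card = p.1.1 + 1)
    (hs : Function.Surjective e)
    (x : MvPolynomial ((Σ i : Fin s, Fin (α i)) × Fin 2) R)
    (hx : x ∈ blockChowInvariants R s α 2) :
    ∃ y z_, y ∈ Subalgebra.map (rename (fun q : Fin n × Fin 2 => (e q.1, q.2)))
      (chowInvariants R n 2) ∧
      z_ ∈ Subalgebra.map (rename (fun q : Fin n × Fin 2 => (e q.1, q.2)))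
      (chowInvariants R n 2) ∧ z_ ≠ 0 ∧ z_ * x = y := by
  classical
  choose t ht using hs
  let w : MvPolynomial (Fin n × Fin 2) R := ∏ a : Fin n × Fin n,
    if e a.1 = e a.2 then 1 else X (a.1, 0) - X (a.2, 0)
  let W : Equiv.Perm (Fin n) → MvPolynomial ((Σ i : Fin s, Fin (α i)) × Fin 2) R :=
    fun σ => ∏ a : Fin n × Fin n,
      if e a.1 = e a.2 then 1 else X (e (σ a.1), 0) - X (e (σ a.2), 0)
  have hW : ∀ σ, rename (fun q : Fin n × Fin 2 => (e q.1, q.2))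
      (rename (fun q : Fin n × Fin 2 => (σ q.1, q.2)) w) = W σ := by
    intro σ
    simp only [w, W, map_prod]
    refine Finset.prod_congr rfl fun a _ => ?_
    split_ifs <;> simp
  have hgood : ∀ σ, W σ ≠ 0 → ∀ i j, e i ≠ e j → e (σ i) ≠ e (σ j) := by
    intro σ h i j hij heq
    apply h
    refine Finset.prod_eq_zero (Finset.mem_univ (i, j)) ?_
    simp [hij, heq]
  have hxW : ∀ σ : Equiv.Perm (Fin n),
      rename (fun q : (Σ i : Fin s, Fin (α i)) × Fin 2 => (e (σ (t q.1)), q.2)) x * W σ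
        = W σ * x := by
    intro σ
    by_cases h : W σ = 0
    · simp [h]
    obtain ⟨-, π, hπ, hπ1⟩ := good_perm e he t ht σ (hgood σ h)
    have := hx π hπ1
    simp only [hπ] at this
    rw [this, mul_comm]
  have hWW : ∀ σ, W σ = 0 ∨ W σ = W 1 := by
    intro σ
    by_cases h : W σ = 0
    · exact Or.inl h
    right
    obtain ⟨hiff, -⟩ := good_perm e he t ht σ (hgood σ h)
    refine Fintype.prod_equiv (Equiv.prodCongr σ σ) _ _ fun a => ?_
    simp [hiff]
  have hW1 : W 1 ≠ 0 := by
    refine Finset.prod_ne_zero_iff.2 fun a _ => ?_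
    split_ifs with h
    · exact one_ne_zero
    · rw [sub_ne_zero]
      intro h'
      exact h (congrArg Prod.fst (X_injective h'))
  have hz : ∑ σ, W σ ≠ 0 := by
    have h1 : ∀ σ, W σ = if W σ = 0 then 0 else W 1 := by
      intro σ
      split_ifs with h
      · exact h
      · exact (hWW σ).resolve_left h
    rw [Finset.sum_congr rfl fun σ _ => h1 σ, Finset.sum_ite, Finset.sum_const_zero, zero_add,
      Finset.sum_const, nsmul_eq_mul]
    refine mul_ne_zero ?_ hW1
    rw [Nat.cast_ne_zero]
    exact Finset.card_ne_zero.2 ⟨1, by simpa using hW1⟩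
  let x' : MvPolynomial (Fin n × Fin 2) R :=
    rename (fun q : (Σ i : Fin s, Fin (α i)) × Fin 2 => (t q.1, q.2)) x
  refine ⟨_, ∑ σ, W σ, ⟨_, sym_mem (x' * w), rfl⟩, ⟨_, sym_mem w, ?_⟩, hz, ?_⟩
  · change rename _ _ = _
    rw [map_sum]
    exact Finset.sum_congr rfl fun σ _ => hW σ
  · change _ = rename _ _
    rw [map_sum, Finset.sum_mul]
    refine Finset.sum_congr rfl fun σ _ => ?_
    rw [← hxW, map_mul, map_mul, hW]
    congr 1
    simp only [x']
    rw [rename_rename, rename_rename]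
    rfl

theorem block_normal {R : Type*} [CommRing R] [IsDomain R] {s : ℕ} {α : Fin s → ℕ}
    (h : IsIntegrallyClosed (MvPolynomial ((Σ i : Fin s, Fin (α i)) × Fin 2) R)) :
    IsIntegrallyClosed ↥(blockChowInvariants R s α 2) := by
  set A := blockChowInvariants R s α 2 with hA
  let P := MvPolynomial ((Σ i : Fin s, Fin (α i)) × Fin 2) R
  rw [isIntegrallyClosed_iff (FractionRing A)]
  intro x hx
  have hj : Function.Injective (algebraMap A P) := Subtype.val_injective
  let φ : FractionRing A →+* FractionRing P := IsFractionRing.map hj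
  have hφ : ∀ a : A, φ (algebraMap A (FractionRing A) a)
      = algebraMap P (FractionRing P) (algebraMap A P a) := fun a => by
    simp only [φ, IsFractionRing.map, IsLocalization.map_eq]
  have hx' : IsIntegral P (φ x) :=
    IsIntegral.map_of_comp_eq (algebraMap A P) φ (RingHom.ext fun a => (hφ a).symm) hx
  obtain ⟨c, hc⟩ := (isIntegrallyClosed_iff (FractionRing P)).1 h hx'
  obtain ⟨a, b, hb, rfl⟩ := IsFractionRing.div_surjective (A := A) x
  have hb0 : b ≠ 0 := nonZeroDivisors.ne_zero hb
  have hb' : (b : P) ≠ 0 := fun h => hb0 (Subtype.ext h)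
  have hbF : algebraMap P (FractionRing P) (b : P) ≠ 0 := by simpa using hb'
  have hbF' : algebraMap A (FractionRing A) b ≠ 0 := fun h => hb0
    (IsFractionRing.injective A (FractionRing A) (by rw [h, map_zero]))
  rw [map_div₀, hφ, hφ] at hc
  have hc' : c * (b : P) = (a : P) := by
    apply IsFractionRing.injective P (FractionRing P)
    rw [map_mul]
    exact (eq_div_iff hbF).1 hc
  have hcA : c ∈ A := by
    intro σ hσ
    have h1 := congrArg (rename (fun q : (Σ i : Fin s, Fin (α i)) × Fin 2 => (σ q.1, q.2))) hc'
    rw [map_mul, b.2 σ hσ, a.2 σ hσ, ← hc'] at h1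
    exact mul_right_cancel₀ hb' h1
  refine ⟨⟨c, hcA⟩, ?_⟩
  rw [eq_div_iff hbF', ← map_mul]
  congr 1
  exact Subtype.ext hc'

universe u

/-- the relative `τ_μ` is the normalization of the closure of the relative
stratum `Chowⁿ_μ(T*_X/X)`. -/
theorem relative_tau_mu_is_normalization_of_stratum_closure
    (k R : Type u) [Field k] [IsAlgClosed k] [CharZero k]
    [CommRing R] [IsDomain R] [Algebra k R] [Algebra.Smooth k R]
    (hdim : ringKrullDim R = 2)
    (s n : ℕ) (α : Fin s → ℕ) (hn : ∑ i : Fin s, (i.1 + 1) * α i = n)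
    (e : Fin n → Σ i : Fin s, Fin (α i))
    (he : ∀ p : Σ i : Fin s, Fin (α i),
      (Finset.univ.filter fun j : Fin n => e j = p).card = p.1.1 + 1) :
    letI τ : MvPolynomial (Fin n × Fin 2) R →ₐ[R]
        MvPolynomial ((Σ i : Fin s, Fin (α i)) × Fin 2) R :=
      rename (fun q => (e q.1, q.2))
    letI R₀ : Subalgebra R (MvPolynomial ((Σ i : Fin s, Fin (α i)) × Fin 2) R) :=
      Subalgebra.map τ (chowInvariants R n 2)
    -- (1) the image of `τ_μ*` lands in the invariants
    R₀ ≤ blockChowInvariants R s α 2 ∧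
    -- (2) `Spec R₀` is the closure of the relative stratum
    (∀ f ∈ chowInvariants R n 2, (τ f = 0 ↔
      ∀ (L : Type u) (_ : Field L) (_ : Algebra R L)
        (z : (Σ i : Fin s, Fin (α i)) → Fin 2 → L), Function.Injective z →
        MvPolynomial.eval₂ (algebraMap R L) (fun q : Fin n × Fin 2 => z (e q.1) q.2) f
          = 0)) ∧
    -- (3) integrality
    (∀ x ∈ blockChowInvariants R s α 2, IsIntegral ↥R₀ x) ∧
    -- (4) birationality onto the image
    (∀ x ∈ blockChowInvariants R s α 2, ∃ y z_, y ∈ R₀ ∧ z_ ∈ R₀ ∧ z_ ≠ 0 ∧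
      z_ * x = y) ∧
    -- (5) normality of the source
    IsIntegrallyClosed ↥(blockChowInvariants R s α 2) := by
  have hs : Function.Surjective e := by
    intro p
    have h : (Finset.univ.filter fun j : Fin n => e j = p).Nonempty := by
      rw [← Finset.card_pos, he]
      exact Nat.succ_pos _
    obtain ⟨j, hj⟩ := h
    exact ⟨j, by simpa using hj⟩
  have : CharZero R := charZero_of_injective_algebraMap (algebraMap k R).injective
  refine ⟨tau_image_le e he, ?_, fun x _ => tau_integral e hs x,
    fun x hx => tau_birational e he hs x hx, block_normal (mv_normal k R _)⟩
  intro f _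
  constructor
  · intro h L _ _ z _
    have h2 := congrArg (eval₂ (algebraMap R L) (fun q => z q.1 q.2)) h
    rw [eval₂_rename, eval₂_zero] at h2
    exact h2
  · intro h
    let P := MvPolynomial ((Σ i : Fin s, Fin (α i)) × Fin 2) R
    have hP : Function.Injective (algebraMap P (FractionRing P)) := IsFractionRing.injective _ _
    have h2 := h (FractionRing P) inferInstance inferInstance
      (fun p l => algebraMap P (FractionRing P) (X (p, l))) (by
        intro p q hpq
        have h3 := hP (congrFun hpq 0)
        exact congrArg Prod.fst (X_injective h3))
    apply hP
    rw [map_zero, ← h2, rename_eq_aeval, aeval_def, eval₂_comp_left,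
      ← IsScalarTower.algebraMap_eq]
    rfl
end
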